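/- arXiv:1010.5934 — 2 statements merged into one kernel-verified Lean document; each statement's English description precedes it below -/
import Mathlib

section
/- For every n ≥ 1, T²_n = n!·X^n·(L_n ∘ (−X) − L_{n−1} ∘ (−X)) as an identity in ℚ[X], where L_n is the n-th Laguerre polynomial and L_n ∘ (−X) denotes composition of L_n with −X. (This expresses the second-order Touchard polynomials through Laguerre polynomials; note T²_n(x) = n!·x^n·(L_n(−x) − L_{n−1}(−x)).) -/
open Polynomial Finset

/-- The second-order Touchard polynomials over ℚ, defined by `T² 0 = 1` and
`T² (n+1) = X² * (T² n + (T² n)')`. -/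
noncomputable def Touchard2 : ℕ → Polynomial ℚ
  | 0 => 1
  | n + 1 => X ^ 2 * (Touchard2 n + derivative (Touchard2 n))

/-- The Laguerre polynomials `Lₙ = ∑_{k=0}^n ((-1)ᵏ/k!) C(n,k) Xᵏ` over ℚ. -/
noncomputable def laguerre (n : ℕ) : Polynomial ℚ :=
  ∑ k ∈ range (n + 1), C ((-1 : ℚ) ^ k / (k.factorial : ℚ) * (n.choose k : ℚ)) * X ^ k

theorem laguerre_comp_neg_X_coeff (n k : ℕ) :
    ((laguerre n).comp (-X)).coeff k = (n.choose k : ℚ) / k.factorial := by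
  have hX : (-X : ℚ[X]) = C (-1) * X := by simp
  rw [hX, comp_C_mul_X_coeff, laguerre, finsetSum_coeff]
  simp only [coeff_C_mul_X_pow, Finset.sum_ite_eq, Finset.mem_range]
  have hsq : (-1 : ℚ) ^ k * (-1) ^ k = 1 := by rw [← mul_pow]; simp
  split_ifs with h
  · linear_combination ((n.choose k : ℚ) / k.factorial) * hsq
  · rw [Nat.choose_eq_zero_of_lt (by omega)]
    simp

theorem laguerre_sub_comp_neg_X_coeff_zero (n : ℕ) :
    ((laguerre (n + 1)).comp (-X) - (laguerre n).comp (-X)).coeff 0 = 0 := by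
  rw [coeff_sub, laguerre_comp_neg_X_coeff, laguerre_comp_neg_X_coeff]
  simp

theorem laguerre_sub_comp_neg_X_coeff_succ (n j : ℕ) :
    ((laguerre (n + 1)).comp (-X) - (laguerre n).comp (-X)).coeff (j + 1) =
      (n.choose j : ℚ) / (j + 1).factorial := by
  rw [coeff_sub, laguerre_comp_neg_X_coeff, laguerre_comp_neg_X_coeff, Nat.choose_succ_succ]
  push_cast
  ring

/-- The recurrence for `Lₙ₊₁(-x) - Lₙ(-x)` that matches the Touchard recursion. -/
theorem laguerre_sub_comp_neg_X_succ (n : ℕ) :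
    C ((n : ℚ) + 2) * ((laguerre (n + 2)).comp (-X) - (laguerre (n + 1)).comp (-X)) =
      X * ((laguerre (n + 1)).comp (-X) - (laguerre n).comp (-X)) +
      C ((n : ℚ) + 1) * ((laguerre (n + 1)).comp (-X) - (laguerre n).comp (-X)) +
      X * derivative ((laguerre (n + 1)).comp (-X) - (laguerre n).comp (-X)) := by
  ext k
  rcases k with _ | _ | i
  · rw [coeff_add, coeff_add, coeff_C_mul, coeff_C_mul, coeff_X_mul_zero, coeff_X_mul_zero,
      laguerre_sub_comp_neg_X_coeff_zero, laguerre_sub_comp_neg_X_coeff_zero]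
    simp
  · rw [coeff_add, coeff_add, coeff_C_mul, coeff_C_mul, coeff_X_mul, coeff_X_mul,
      coeff_derivative, laguerre_sub_comp_neg_X_coeff_zero, laguerre_sub_comp_neg_X_coeff_succ,
      laguerre_sub_comp_neg_X_coeff_succ]
    simp
    ring
  · rw [coeff_add, coeff_add, coeff_C_mul, coeff_C_mul, coeff_X_mul, coeff_X_mul,
      coeff_derivative, laguerre_sub_comp_neg_X_coeff_succ, laguerre_sub_comp_neg_X_coeff_succ,
      laguerre_sub_comp_neg_X_coeff_succ, Nat.choose_succ_succ, Nat.factorial_succ (i + 1)]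
    have hf : ((i + 1).factorial : ℚ) ≠ 0 := by positivity
    have hi : (i : ℚ) + 1 + 1 ≠ 0 := by positivity
    have hc : (n.choose (i + 1) : ℚ) * (i + 1) = n.choose i * (n - i) := by
      rcases le_or_gt i n with h | h
      · rw [← Nat.cast_sub h]
        exact_mod_cast Nat.choose_succ_right_eq n i
      · rw [Nat.choose_eq_zero_of_lt h, Nat.choose_eq_zero_of_lt (by omega)]
        simp
    push_cast
    field_simp
    linear_combination -hc

/-- The second-order Touchard polynomials in terms of Laguerre polynomials:
`T²ₙ(x) = n! xⁿ (Lₙ(-x) - L_{n-1}(-x))` for `n ≥ 1`. -/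
theorem touchard2_eq_laguerre (n : ℕ) (hn : 1 ≤ n) :
    Touchard2 n =
      C ((n.factorial : ℚ)) * X ^ n *
        ((laguerre n).comp (-X) - (laguerre (n - 1)).comp (-X)) := by
  obtain ⟨m, rfl⟩ := Nat.exists_eq_add_of_le' hn
  clear hn
  rw [Nat.add_sub_cancel]
  induction m with
  | zero =>
    simp [Touchard2, laguerre, Finset.sum_range_succ]
    ring
  | succ m ih =>
    rw [Touchard2, ih, Nat.factorial_succ (m + 1)]
    have h := laguerre_sub_comp_neg_X_succ m
    generalize (laguerre (m + 1)).comp (-X) - (laguerre m).comp (-X) = P at h ⊢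
    rw [derivative_mul, derivative_C_mul, derivative_X_pow]
    push_cast [Nat.add_sub_cancel] at h ⊢
    simp only [map_add, map_mul, map_natCast, map_one, map_ofNat] at h ⊢
    linear_combination (-((m + 1).factorial : ℚ[X]) * X ^ (m + 2)) * h
end

section
/- Fix an integer m ≥ 2. Define the linear operators N, E : ℝ[X] → ℝ[X] by N p = X^m·p + X^m·p' and E p = X^m·p', where p' is the formal derivative. Then for every k ∈ ℕ and every p ∈ ℝ[X], N^[k] p = ∑_{r=0}^k C(k,r)·Tᵐ_{k−r}·(E^[r] p), where N^[k] and E^[r] denote functional iterates and C(k,r) is the binomial coefficient. -/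
open Polynomial Finset

/-- The `m`-th order Touchard polynomials, defined by `Tᵐ 0 = 1` and
`Tᵐ (n+1) = Xᵐ * (Tᵐ n + (Tᵐ n)')`. -/
noncomputable def TouchardHigher (m : ℕ) : ℕ → Polynomial ℝ
  | 0 => 1
  | n + 1 => X ^ m * (TouchardHigher m n + derivative (TouchardHigher m n))

/-- The multiplicative operator `N = xᵐ(1 + ∂ₓ)`. -/
noncomputable def Nop (m : ℕ) (p : Polynomial ℝ) : Polynomial ℝ :=
  X ^ m * p + X ^ m * derivative p

/-- The operator `E = xᵐ ∂ₓ`. -/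
noncomputable def Eop (m : ℕ) (p : Polynomial ℝ) : Polynomial ℝ :=
  X ^ m * derivative p

theorem Nop_sum {ι : Type*} (m : ℕ) (s : Finset ι) (f : ι → ℝ[X]) :
    Nop m (∑ i ∈ s, f i) = ∑ i ∈ s, Nop m (f i) := by
  simp only [Nop, derivative_sum, mul_sum, sum_add_distrib]

theorem Nop_natCast_mul (m n : ℕ) (p : ℝ[X]) :
    Nop m ((n : ℝ[X]) * p) = (n : ℝ[X]) * Nop m p := by
  simp only [Nop, derivative_natCast_mul]
  ring

theorem Nop_touchardHigher_mul (m n : ℕ) (q : ℝ[X]) :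
    Nop m (TouchardHigher m n * q) =
      TouchardHigher m (n + 1) * q + TouchardHigher m n * Eop m q := by
  simp only [Nop, Eop, TouchardHigher, derivative_mul]
  ring

theorem Nop_iterate_eq_sum_antidiagonal (m k : ℕ) (p : ℝ[X]) :
    (Nop m)^[k] p = ∑ ij ∈ antidiagonal k,
      (k.choose ij.1 : ℝ[X]) * (TouchardHigher m ij.2 * (Eop m)^[ij.1] p) := by
  induction k with
  | zero => simp [TouchardHigher]
  | succ k ih =>
    rw [sum_antidiagonal_choose_succ_mul (fun i j => TouchardHigher m j * (Eop m)^[i] p),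
      Function.iterate_succ_apply', ih, Nop_sum, ← sum_add_distrib]
    refine sum_congr rfl fun ij hij => ?_
    rw [Nop_natCast_mul, Nop_touchardHigher_mul, Function.iterate_succ_apply',
      Nat.choose_symm_of_eq_add (mem_antidiagonal.1 hij).symm]
    ring

/-- Operational identity `(xᵐ + xᵐ∂ₓ)ᵏ = ∑_{r=0}^k C(k,r) Tᵐ_{k-r}(x) (xᵐ∂ₓ)ʳ` for `m ≥ 2`. -/
theorem touchardHigher_operational_identity (m : ℕ) (hm : 2 ≤ m) (k : ℕ) (p : Polynomial ℝ) :
    (Nop m)^[k] p =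
      ∑ r ∈ range (k + 1), (k.choose r : ℝ[X]) * TouchardHigher m (k - r) * (Eop m)^[r] p := by
  rw [Nop_iterate_eq_sum_antidiagonal, Nat.sum_antidiagonal_eq_sum_range_succ_mk]
  simp only [mul_assoc]
end
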